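/- Let T be the Bolyai–Rényi map, P its pressure function, and μ a T-invariant Borel probability measure on [0,1) absolutely continuous with respect to Lebesgue measure. Then P is differentiable at t = 0 with derivative P'(0) = −∫ log(2x+2) dμ(x), i.e. the derivative of the pressure at 0 equals minus the metric entropy h(μ). -/

import Mathlib

open MeasureTheory Real Filter

/-- The Bolyai–Rényi map. -/
noncomputable def T (x : ℝ) : ℝ :=
  if x < Real.sqrt 2 - 1 then x ^ 2 + 2 * x
  else if x < Real.sqrt 3 - 1 then x ^ 2 + 2 * x - 1
  else x ^ 2 + 2 * x - 2

/-- The transfer operator of the Bolyai–Rényi map at parameter `t`. -/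
noncomputable def Lt (t : ℝ) (f : ℝ → ℝ) : ℝ → ℝ := fun x =>
  ∑ i ∈ Finset.Icc (1 : ℕ) 3,
    (2 * Real.sqrt ((i : ℝ) + x)) ^ (-(1 + t)) * f (Real.sqrt ((i : ℝ) + x) - 1)

/-- Supremum norm over the interval `[0,1]`. -/
noncomputable def supNorm (f : ℝ → ℝ) : ℝ := ⨆ x : Set.Icc (0 : ℝ) 1, |f x|

/-- The pressure function of the Bolyai–Rényi map. -/
noncomputable def P (t : ℝ) : ℝ :=
  limsup (fun n : ℕ => (1 / n : ℝ) * Real.log (supNorm ((Lt t)^[n] (fun _ => 1)))) atTop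

/-- inverse branches -/
noncomputable def br (i : ℕ) (x : ℝ) : ℝ := Real.sqrt ((i : ℝ) + x) - 1

/-- derivative of inverse branches -/
noncomputable def wt (i : ℕ) (x : ℝ) : ℝ := 1 / (2 * Real.sqrt ((i : ℝ) + x))

/-- transfer operator at parameter zero -/
noncomputable def L0 (f : ℝ → ℝ) (x : ℝ) : ℝ := ∑ i ∈ Finset.Icc (1 : ℕ) 3, wt i x * f (br i x)

/-- Lipschitz on the unit interval -/
def LipI (f : ℝ → ℝ) (K : ℝ) : Prop :=
  ∀ x ∈ Set.Icc (0 : ℝ) 1, ∀ y ∈ Set.Icc (0 : ℝ) 1, |f x - f y| ≤ K * |x - y|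

lemma br_mem {i : ℕ} (hi : i ∈ Finset.Icc (1 : ℕ) 3) {x : ℝ} (hx : x ∈ Set.Icc (0 : ℝ) 1) :
    br i x ∈ Set.Icc (0 : ℝ) 1 := by
  rw [Finset.mem_Icc] at hi
  have h1 : (1 : ℝ) ≤ i := by exact_mod_cast hi.1
  have h3 : (i : ℝ) ≤ 3 := by exact_mod_cast hi.2
  constructor
  · have := Real.le_sqrt_of_sq_le (show (1 : ℝ) ^ 2 ≤ i + x by linarith [hx.1])
    unfold br; linarith
  · have := Real.sqrt_le_sqrt (show (i : ℝ) + x ≤ 2 ^ 2 by linarith [hx.2])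
    rw [Real.sqrt_sq (by norm_num)] at this
    unfold br; linarith

lemma wt_nonneg (i : ℕ) (x : ℝ) : 0 ≤ wt i x := by unfold wt; positivity

lemma wt_le {i : ℕ} (hi : i ∈ Finset.Icc (1 : ℕ) 3) {x : ℝ} (hx : x ∈ Set.Icc (0 : ℝ) 1) :
    wt i x ≤ 1 / 2 := by
  have := (br_mem hi hx).1
  unfold br at this
  unfold wt
  apply one_div_le_one_div_of_le <;> linarith

lemma sqrt_lb {i : ℕ} {x : ℝ} (hx : x ∈ Set.Icc (0 : ℝ) 1) :
    Real.sqrt i ≤ Real.sqrt (i + x) := Real.sqrt_le_sqrt (by linarith [hx.1])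

lemma br_diff {i : ℕ} (hi : i ∈ Finset.Icc (1 : ℕ) 3) {x y : ℝ} (hx : x ∈ Set.Icc (0 : ℝ) 1)
    (hy : y ∈ Set.Icc (0 : ℝ) 1) : wt i x * |br i x - br i y| ≤ 1 / (4 * i) * |x - y| := by
  have h1 : (1 : ℝ) ≤ i := by exact_mod_cast (Finset.mem_Icc.1 hi).1
  have hix : (0 : ℝ) ≤ i + x := by linarith [hx.1]
  have hiy : (0 : ℝ) ≤ i + y := by linarith [hy.1]
  have ha := sqrt_lb (i := i) hx
  have hb := sqrt_lb (i := i) hy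
  have hs : 0 < Real.sqrt i := Real.sqrt_pos.2 (by linarith)
  have hss := Real.mul_self_sqrt (show (0 : ℝ) ≤ i by linarith)
  have hxx := Real.mul_self_sqrt hix
  have hyy := Real.mul_self_sqrt hiy
  unfold br wt
  set a := Real.sqrt (i + x)
  set b := Real.sqrt (i + y)
  set s := Real.sqrt i
  have hxy : x - y = (a - b) * (a + b) := by linarith
  have : |x - y| = |a - b| * (a + b) := by
    rw [hxy, abs_mul, abs_of_pos (show 0 < a + b by linarith)]
  rw [this, show a - 1 - (b - 1) = a - b by ring, ← hss]
  have hap : 0 < a := by linarith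
  have : 1 / (2 * a) ≤ 1 / (4 * (s * s)) * (a + b) := by
    rw [div_mul_eq_mul_div, div_le_div_iff₀ (by positivity) (by positivity)]
    nlinarith
  calc _ ≤ 1 / (4 * (s * s)) * (a + b) * |a - b| := by gcongr
    _ = _ := by ring

lemma wt_diff {i : ℕ} (hi : i ∈ Finset.Icc (1 : ℕ) 3) {x y : ℝ} (hx : x ∈ Set.Icc (0 : ℝ) 1)
    (hy : y ∈ Set.Icc (0 : ℝ) 1) :
    |wt i x - wt i y| ≤ 1 / (4 * (i * Real.sqrt i)) * |x - y| := by
  have h1 : (1 : ℝ) ≤ i := by exact_mod_cast (Finset.mem_Icc.1 hi).1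
  have hix : (0 : ℝ) ≤ i + x := by linarith [hx.1]
  have hiy : (0 : ℝ) ≤ i + y := by linarith [hy.1]
  have ha := sqrt_lb (i := i) hx
  have hb := sqrt_lb (i := i) hy
  have hs : 0 < Real.sqrt i := Real.sqrt_pos.2 (by linarith)
  have hss := Real.mul_self_sqrt (show (0 : ℝ) ≤ i by linarith)
  have hxx := Real.mul_self_sqrt hix
  have hyy := Real.mul_self_sqrt hiy
  unfold wt
  set a := Real.sqrt (i + x)
  set b := Real.sqrt (i + y)
  set s := Real.sqrt i
  have hap : 0 < a := by linarith
  have hbp : 0 < b := by linarith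
  have hxy : x - y = (a - b) * (a + b) := by linarith
  have : |x - y| = |a - b| * (a + b) := by
    rw [hxy, abs_mul, abs_of_pos (show 0 < a + b by linarith)]
  rw [this, ← hss]
  have e : 1 / (2 * a) - 1 / (2 * b) = -((a - b) * (1 / (2 * (a * b)))) := by
    field_simp; ring
  rw [e, abs_neg, abs_mul, abs_of_pos (show 0 < 1 / (2 * (a * b)) by positivity)]
  have : 1 / (2 * (a * b)) ≤ 1 / (4 * (s * s * s)) * (a + b) := by
    rw [div_mul_eq_mul_div, div_le_div_iff₀ (by positivity) (by positivity)]
    have h2 : s * s ≤ a * b := by gcongr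
    have h3 : s * s * (2 * s) ≤ (a * b) * (a + b) := by gcongr; linarith
    nlinarith
  calc _ ≤ |a - b| * (1 / (4 * (s * s * s)) * (a + b)) := by gcongr
    _ = _ := by ring

lemma L0_lip {f : ℝ → ℝ} {K M : ℝ} (hf : LipI f K) (hM : ∀ x ∈ Set.Icc (0 : ℝ) 1, |f x| ≤ M) :
    LipI (L0 f) (11 / 24 * K + 39 / 100 * M) := by
  intro x hx y hy
  have hK : 0 ≤ K := by
    have := hf 0 (by simp) 1 (by simp)
    have h2 := abs_nonneg (f 0 - f 1)
    norm_num at this; linarith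
  have hM0 : 0 ≤ M := (abs_nonneg _).trans (hM x hx)
  have key : ∀ i ∈ Finset.Icc (1 : ℕ) 3, |wt i x * f (br i x) - wt i y * f (br i y)| ≤
      (K * (1 / (4 * i)) + M * (1 / (4 * (i * Real.sqrt i)))) * |x - y| := by
    intro i hi
    have e : wt i x * f (br i x) - wt i y * f (br i y) =
      wt i x * (f (br i x) - f (br i y)) + (wt i x - wt i y) * f (br i y) := by ring
    rw [e]
    refine (abs_add_le _ _).trans ?_
    rw [abs_mul, abs_mul, abs_of_nonneg (wt_nonneg i x)]
    have h1 := hf _ (br_mem hi hx) _ (br_mem hi hy)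
    have h2 := hM _ (br_mem hi hy)
    calc _ ≤ wt i x * (K * |br i x - br i y|) + (1 / (4 * (i * Real.sqrt i)) * |x - y|) * M := by
          gcongr
          · exact wt_nonneg i x
          · exact wt_diff hi hx hy
      _ = K * (wt i x * |br i x - br i y|) + (1 / (4 * (i * Real.sqrt i)) * |x - y|) * M := by ring
      _ ≤ K * (1 / (4 * i) * |x - y|) + (1 / (4 * (i * Real.sqrt i)) * |x - y|) * M := by
          have := mul_le_mul_of_nonneg_left (br_diff hi hx hy) hK
          linarith
      _ = _ := by ring
  unfold L0
  rw [← Finset.sum_sub_distrib]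
  refine (Finset.abs_sum_le_sum_abs _ _).trans ((Finset.sum_le_sum key).trans ?_)
  rw [← Finset.sum_mul]
  refine mul_le_mul_of_nonneg_right ?_ (abs_nonneg _)
  have e : Finset.Icc (1 : ℕ) 3 = {1, 2, 3} := by decide
  rw [e]
  have s2 : (1.4 : ℝ) ≤ Real.sqrt 2 := Real.le_sqrt_of_sq_le (by norm_num)
  have s3 : (1.7 : ℝ) ≤ Real.sqrt 3 := Real.le_sqrt_of_sq_le (by norm_num)
  have c2 : 1 / (4 * (2 * Real.sqrt 2)) ≤ (9 / 100 : ℝ) := by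
    rw [div_le_div_iff₀ (by positivity) (by norm_num)]; linarith
  have c3 : 1 / (4 * (3 * Real.sqrt 3)) ≤ (5 / 100 : ℝ) := by
    rw [div_le_div_iff₀ (by positivity) (by norm_num)]; linarith
  rw [Finset.sum_insert (by decide), Finset.sum_insert (by decide), Finset.sum_singleton]
  norm_num at c2 c3 ⊢
  have h2 := mul_le_mul_of_nonneg_left c2 hM0
  have h3 := mul_le_mul_of_nonneg_left c3 hM0
  linarith

lemma LipI.cont {f : ℝ → ℝ} {K : ℝ} (hf : LipI f K) : ContinuousOn f (Set.Icc 0 1) := by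
  have : LipschitzOnWith (Real.toNNReal K) f (Set.Icc 0 1) := by
    apply LipschitzOnWith.of_dist_le_mul
    intro x hx y hy
    rw [Real.dist_eq, Real.dist_eq]
    refine (hf x hx y hy).trans ?_
    gcongr
    exact Real.le_coe_toNNReal K
  exact this.continuousOn

lemma LipI.intg {f : ℝ → ℝ} {K : ℝ} (hf : LipI f K) : IntegrableOn f (Set.Ico 0 1) :=
  hf.cont.integrableOn_Icc.mono_set Set.Ico_subset_Icc_self

lemma bound_of_mean {f : ℝ → ℝ} {K : ℝ} (hf : LipI f K) (h0 : ∫ x in Set.Ico (0 : ℝ) 1, f x = 0)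
    {x : ℝ} (hx : x ∈ Set.Icc (0 : ℝ) 1) : |f x| ≤ K / 2 := by
  have hK : 0 ≤ K := by
    have := hf 0 (by simp) 1 (by simp)
    have h2 := abs_nonneg (f 0 - f 1)
    norm_num at this; linarith
  have hc : ∫ y in Set.Ico (0 : ℝ) 1, f x = f x := by simp
  have h1 : f x = ∫ y in Set.Ico (0 : ℝ) 1, (f x - f y) := by
    rw [integral_sub (by simp) hf.intg, h0, hc, sub_zero]
  have h2 : ∫ y in Set.Ico (0 : ℝ) 1, K * (x + y * (1 - 2 * x)) = K / 2 := by
    rw [integral_Ico_eq_integral_Ioc, ← intervalIntegral.integral_of_le (by norm_num)]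
    rw [intervalIntegral.integral_const_mul, intervalIntegral.integral_add (by simp)
      (by apply Continuous.intervalIntegrable; fun_prop), intervalIntegral.integral_mul_const]
    simp; ring
  rw [← h2]
  conv_lhs => rw [h1]
  rw [← Real.norm_eq_abs]
  apply norm_integral_le_of_norm_le
  · exact (Continuous.integrableOn_Icc (by fun_prop)).mono_set Set.Ico_subset_Icc_self
  · refine (ae_restrict_iff' measurableSet_Ico).2 (Filter.Eventually.of_forall fun y hy => ?_)
    refine (hf x hx y (Set.Ico_subset_Icc_self hy)).trans ?_
    gcongr
    rw [abs_le]
    constructor <;> nlinarith [mul_nonneg hx.1 (sub_nonneg.2 hy.2.le),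
      mul_nonneg hy.1 (sub_nonneg.2 hx.2)]
lemma br_image {i : ℕ} (hi : i ∈ Finset.Icc (1 : ℕ) 3) :
    br i '' Set.Ico 0 1 = Set.Ico (Real.sqrt i - 1) (Real.sqrt (i + 1) - 1) := by
  have h1 : (1 : ℝ) ≤ i := by exact_mod_cast (Finset.mem_Icc.1 hi).1
  ext y
  constructor
  · rintro ⟨x, hx, rfl⟩
    refine ⟨?_, ?_⟩
    · have := Real.sqrt_le_sqrt (show (i : ℝ) ≤ i + x by linarith [hx.1])
      unfold br; linarith
    · have := Real.sqrt_lt_sqrt (by linarith [hx.1]) (show (i : ℝ) + x < i + 1 by linarith [hx.2])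
      unfold br; linarith
  · rintro ⟨ha, hb⟩
    have hs : 0 ≤ Real.sqrt i := Real.sqrt_nonneg _
    have h2 : Real.sqrt i ≤ y + 1 := by linarith
    have h3 : y + 1 < Real.sqrt (i + 1) := by linarith
    rw [Real.sqrt_le_left (by linarith)] at h2
    rw [Real.lt_sqrt (by linarith)] at h3
    refine ⟨(y + 1) ^ 2 - i, ⟨by linarith, by linarith⟩, ?_⟩
    unfold br
    rw [show (i : ℝ) + ((y + 1) ^ 2 - i) = (y + 1) ^ 2 by ring, Real.sqrt_sq (by linarith)]
    ring

lemma br_inj {i : ℕ} (hi : i ∈ Finset.Icc (1 : ℕ) 3) : Set.InjOn (br i) (Set.Ico 0 1) := by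
  have h1 : (1 : ℝ) ≤ i := by exact_mod_cast (Finset.mem_Icc.1 hi).1
  intro x hx y hy h
  unfold br at h
  have := (Real.sqrt_inj (show (0 : ℝ) ≤ i + x by linarith [hx.1])
    (show (0 : ℝ) ≤ i + y by linarith [hy.1])).1 (by linarith)
  linarith

lemma br_deriv {i : ℕ} (hi : i ∈ Finset.Icc (1 : ℕ) 3) {x : ℝ} (hx : x ∈ Set.Ico (0 : ℝ) 1) :
    HasDerivWithinAt (br i) (wt i x) (Set.Ico 0 1) x := by
  have h1 : (1 : ℝ) ≤ i := by exact_mod_cast (Finset.mem_Icc.1 hi).1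
  have := (((hasDerivAt_id x).const_add (i : ℝ)).sqrt (by simp; linarith [hx.1])).sub_const 1
  exact this.hasDerivWithinAt

lemma br_image_sub {i : ℕ} (hi : i ∈ Finset.Icc (1 : ℕ) 3) :
    br i '' Set.Ico 0 1 ⊆ Set.Ico 0 1 := by
  rw [br_image hi]
  rw [Finset.mem_Icc] at hi
  have h1 : (1 : ℝ) ≤ i := by exact_mod_cast hi.1
  have h3 : (i : ℝ) ≤ 3 := by exact_mod_cast hi.2
  apply Set.Ico_subset_Ico
  · have := Real.le_sqrt_of_sq_le (show (1 : ℝ) ^ 2 ≤ i by linarith)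
    linarith
  · have := Real.sqrt_le_sqrt (show (i : ℝ) + 1 ≤ 2 ^ 2 by linarith)
    rw [Real.sqrt_sq (by norm_num)] at this
    linarith

lemma int_br {F : ℝ → ℝ} (hF : IntegrableOn F (Set.Ico 0 1)) {i : ℕ}
    (hi : i ∈ Finset.Icc (1 : ℕ) 3) :
    IntegrableOn (fun x => wt i x * F (br i x)) (Set.Ico 0 1) := by
  have := (integrableOn_image_iff_integrableOn_abs_deriv_smul measurableSet_Ico
    (fun x hx => br_deriv hi hx) (br_inj hi) F).1 (hF.mono_set (br_image_sub hi))
  refine this.congr_fun (fun x hx => ?_) measurableSet_Ico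
  simp only [smul_eq_mul, abs_of_nonneg (wt_nonneg i x)]

lemma int_L0 {F : ℝ → ℝ} (hF : IntegrableOn F (Set.Ico 0 1)) :
    ∫ x in Set.Ico (0 : ℝ) 1, L0 F x = ∫ x in Set.Ico (0 : ℝ) 1, F x := by
  have e1 : ∫ x in Set.Ico (0 : ℝ) 1, L0 F x =
      ∑ i ∈ Finset.Icc (1 : ℕ) 3, ∫ x in Set.Ico (0 : ℝ) 1, wt i x * F (br i x) := by
    unfold L0
    exact integral_finsetSum _ (fun i hi => int_br hF hi)
  have e2 : ∀ i ∈ Finset.Icc (1 : ℕ) 3, ∫ x in Set.Ico (0 : ℝ) 1, wt i x * F (br i x) =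
      ∫ x in (Real.sqrt i - 1)..(Real.sqrt (i + 1) - 1), F x := by
    intro i hi
    rw [intervalIntegral.integral_of_le (by gcongr; linarith), ← integral_Ico_eq_integral_Ioc,
      ← br_image hi, integral_image_eq_integral_abs_deriv_smul measurableSet_Ico
      (fun x hx => br_deriv hi hx) (br_inj hi) F]
    refine setIntegral_congr_fun measurableSet_Ico (fun x hx => ?_)
    simp only [smul_eq_mul, abs_of_nonneg (wt_nonneg i x)]
  have hI : ∀ i ∈ Finset.Icc (1 : ℕ) 3,
      IntervalIntegrable F volume (Real.sqrt i - 1) (Real.sqrt (i + 1) - 1) := by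
    intro i hi
    rw [intervalIntegrable_iff_integrableOn_Ico_of_le (by gcongr; linarith), ← br_image hi]
    exact hF.mono_set (br_image_sub hi)
  rw [e1, Finset.sum_congr rfl e2]
  have e : Finset.Icc (1 : ℕ) 3 = {1, 2, 3} := by decide
  have i1 := hI 1 (by decide)
  have i2 := hI 2 (by decide)
  have i3 := hI 3 (by decide)
  rw [e, Finset.sum_insert (by decide), Finset.sum_insert (by decide), Finset.sum_singleton]
  norm_num at i1 i2 i3 ⊢
  have s4 : Real.sqrt 4 = 2 := by
    rw [show (4 : ℝ) = 2 ^ 2 by norm_num, Real.sqrt_sq (by norm_num)]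
  rw [s4] at *
  rw [intervalIntegral.integral_add_adjacent_intervals i2 i3,
    intervalIntegral.integral_add_adjacent_intervals i1 (i2.trans i3),
    intervalIntegral.integral_of_le (by norm_num), ← integral_Ico_eq_integral_Ioc]

lemma T_br {i : ℕ} (hi : i ∈ Finset.Icc (1 : ℕ) 3) {x : ℝ} (hx : x ∈ Set.Ico (0 : ℝ) 1) :
    T (br i x) = x := by
  have h1 : (1 : ℝ) ≤ i := by exact_mod_cast (Finset.mem_Icc.1 hi).1
  have hm : br i x ∈ br i '' Set.Ico 0 1 := ⟨x, hx, rfl⟩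
  rw [br_image hi] at hm
  have hs : (br i x + 1) ^ 2 = i + x := by
    unfold br
    rw [sub_add_cancel, Real.sq_sqrt (by linarith [hx.1])]
  have s23 : Real.sqrt 2 ≤ Real.sqrt 3 := Real.sqrt_le_sqrt (by norm_num)
  have e : Finset.Icc (1 : ℕ) 3 = {1, 2, 3} := by decide
  rw [e] at hi
  simp only [Finset.mem_insert, Finset.mem_singleton] at hi
  unfold T
  rcases hi with rfl | rfl | rfl
  · norm_num at hm hs ⊢
    rw [if_pos hm.2]; linarith
  · norm_num at hm hs ⊢
    rw [if_neg (by linarith [hm.1]), if_pos hm.2]; linarith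
  · norm_num at hm hs ⊢
    rw [if_neg (by linarith [hm.1]), if_neg (by linarith [hm.1])]; linarith

lemma T_meas : Measurable T := by
  unfold T
  refine Measurable.ite measurableSet_Iio (by fun_prop) ?_
  exact Measurable.ite measurableSet_Iio (by fun_prop) (by fun_prop)

lemma dual_one {F g : ℝ → ℝ} (h : IntegrableOn (fun x => F (T x) * g x) (Set.Ico 0 1)) :
    ∫ x in Set.Ico (0 : ℝ) 1, F (T x) * g x = ∫ x in Set.Ico (0 : ℝ) 1, F x * L0 g x := by
  rw [← int_L0 h]
  refine setIntegral_congr_fun measurableSet_Ico (fun x hx => ?_)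
  simp only [L0, Finset.mul_sum]
  refine Finset.sum_congr rfl fun i hi => ?_
  rw [T_br hi hx]; ring

/-! solving the cohomological equation -/

lemma lip_const {f : ℝ → ℝ} {K : ℝ} (hf : LipI f K) : 0 ≤ K := by
  have := hf 0 (by simp) 1 (by simp)
  have h2 := abs_nonneg (f 0 - f 1)
  norm_num at this; linarith

lemma LipI.mono {f : ℝ → ℝ} {K K' : ℝ} (hf : LipI f K) (h : K ≤ K') : LipI f K' :=
  fun x hx y hy => (hf x hx y hy).trans (by gcongr)

lemma L0_contr {f : ℝ → ℝ} {K : ℝ} (hf : LipI f K) (h0 : ∫ x in Set.Ico (0 : ℝ) 1, f x = 0) :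
    LipI (L0 f) (2 / 3 * K) ∧ ∫ x in Set.Ico (0 : ℝ) 1, L0 f x = 0 := by
  refine ⟨(L0_lip hf fun x hx => bound_of_mean hf h0 hx).mono ?_, ?_⟩
  · have := lip_const hf
    linarith
  · rw [int_L0 hf.intg, h0]

lemma L0_iter {f : ℝ → ℝ} {K : ℝ} (hf : LipI f K) (h0 : ∫ x in Set.Ico (0 : ℝ) 1, f x = 0)
    (n : ℕ) : LipI (L0^[n] f) ((2 / 3) ^ n * K) ∧ ∫ x in Set.Ico (0 : ℝ) 1, (L0^[n] f) x = 0 := by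
  induction n with
  | zero => simpa using ⟨hf, h0⟩
  | succ n ih =>
    rw [Function.iterate_succ_apply']
    have := L0_contr ih.1 ih.2
    rwa [← mul_assoc, ← pow_succ'] at this

lemma solve {w : ℝ → ℝ} {K : ℝ} (hw : LipI w K) (h0 : ∫ x in Set.Ico (0 : ℝ) 1, w x = 0) :
    ∃ v : ℝ → ℝ, LipI v (3 * K) ∧ (∫ x in Set.Ico (0 : ℝ) 1, v x = 0) ∧
      ∀ x ∈ Set.Icc (0 : ℝ) 1, v x - L0 v x = w x := by
  have hK := lip_const hw
  have hb : ∀ n, ∀ x ∈ Set.Icc (0 : ℝ) 1, |(L0^[n] w) x| ≤ (2 / 3) ^ n * K / 2 :=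
    fun n x hx => bound_of_mean (L0_iter hw h0 n).1 (L0_iter hw h0 n).2 hx
  have hg : HasSum (fun n : ℕ => (2 / 3 : ℝ) ^ n * K) (3 * K) := by
    have := (hasSum_geometric_of_lt_one (r := (2 / 3 : ℝ)) (by norm_num) (by norm_num)).mul_right K
    norm_num at this ⊢
    exact this
  have hs : ∀ x ∈ Set.Icc (0 : ℝ) 1, Summable fun n => (L0^[n] w) x := fun x hx =>
    Summable.of_norm_bounded (hg.summable.div_const 2) (fun n => hb n x hx)
  refine ⟨fun x => ∑' n, (L0^[n] w) x, ?_, ?_, ?_⟩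
  · intro x hx y hy
    rw [← (hs x hx).tsum_sub (hs y hy), ← Real.norm_eq_abs]
    exact tsum_of_norm_bounded (hg.mul_right _) fun n => (L0_iter hw h0 n).1 x hx y hy
  · have := hasSum_integral_of_summable_integral_norm (μ := volume.restrict (Set.Ico (0 : ℝ) 1))
      (F := fun n x => (L0^[n] w) x) (fun n => (L0_iter hw h0 n).1.intg) ?_
    · rw [← this.tsum_eq]
      simp [(L0_iter hw h0 _).2]
    · refine Summable.of_nonneg_of_le (fun n => by positivity) (fun n => ?_)
        (hg.summable.div_const 2)
      have h1 : ∫ x in Set.Ico (0 : ℝ) 1, (2 / 3 : ℝ) ^ n * K / 2 = (2 / 3 : ℝ) ^ n * K / 2 := by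
        simp
      rw [← h1]
      refine setIntegral_mono_on (L0_iter hw h0 n).1.intg.norm (by simp) measurableSet_Ico ?_
      intro x hx
      exact hb n x (Set.Ico_subset_Icc_self hx)
  · intro x hx
    have e : L0 (fun x => ∑' n, (L0^[n] w) x) x = ∑' n, (L0^[n + 1] w) x := by
      simp only [Function.iterate_succ_apply']
      unfold L0
      rw [Summable.tsum_finsetSum]
      · refine Finset.sum_congr rfl fun i hi => ?_
        rw [tsum_mul_left]
      · intro i hi
        exact (hs _ (br_mem hi hx)).mul_left _
    rw [e]
    show (∑' n, (L0^[n] w) x) - _ = _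
    rw [(hs x hx).tsum_eq_zero_add]
    simp
lemma exists_h : ∃ h : ℝ → ℝ, ∃ K : ℝ, LipI h K ∧ (∫ x in Set.Ico (0 : ℝ) 1, h x = 1) ∧
    (∀ x ∈ Set.Icc (0 : ℝ) 1, 2 / 5 ≤ h x) ∧ ∀ x ∈ Set.Icc (0 : ℝ) 1, L0 h x = h x := by
  have h1 : LipI (fun _ => (1 : ℝ)) 0 := fun x hx y hy => by simp
  have h2 : LipI (L0 fun _ => (1 : ℝ)) (39 / 100) := by
    have := L0_lip (M := 1) h1 (fun x hx => by simp)
    norm_num at this ⊢; exact this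
  have h3 : LipI (fun x => L0 (fun _ => (1 : ℝ)) x - 1) (39 / 100) := by
    intro x hx y hy
    have := h2 x hx y hy
    rwa [sub_sub_sub_cancel_right]
  have hc : ∫ x in Set.Ico (0 : ℝ) 1, (1 : ℝ) = 1 := by simp
  have h4 : ∫ x in Set.Ico (0 : ℝ) 1, (L0 (fun _ => (1 : ℝ)) x - 1) = 0 := by
    rw [integral_sub h2.intg h1.intg, int_L0 h1.intg, sub_self]
  obtain ⟨v, hv, hv0, hve⟩ := solve h3 h4
  refine ⟨fun x => 1 + v x, 3 * (39 / 100), ?_, ?_, ?_, ?_⟩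
  · intro x hx y hy
    have := hv x hx y hy
    rwa [add_sub_add_left_eq_sub]
  · rw [integral_add h1.intg hv.intg, hv0, hc, add_zero]
  · intro x hx
    have := abs_le.1 (bound_of_mean hv hv0 hx)
    linarith [this.1]
  · intro x hx
    have e : L0 (fun x => 1 + v x) x = L0 (fun _ => 1) x + L0 v x := by
      simp only [L0, mul_add, Finset.sum_add_distrib]
    rw [e]; linarith [hve x hx]

lemma L0_intg {g : ℝ → ℝ} (hg : IntegrableOn g (Set.Ico 0 1)) :
    IntegrableOn (L0 g) (Set.Ico 0 1) := by
  unfold L0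
  exact integrable_finsetSum _ (fun i hi => int_br hg hi)

lemma dual_n {F : ℝ → ℝ} {B : ℝ} (hF : Measurable F) (hB : ∀ x, |F x| ≤ B) (n : ℕ) :
    ∀ {g : ℝ → ℝ}, IntegrableOn g (Set.Ico 0 1) →
    ∫ x in Set.Ico (0 : ℝ) 1, F (T^[n] x) * g x = ∫ x in Set.Ico (0 : ℝ) 1, F x * (L0^[n] g) x := by
  induction n with
  | zero => intro g hg; rfl
  | succ n ih =>
    intro g hg
    simp only [Function.iterate_succ_apply]
    rw [← ih (L0_intg hg)]
    refine dual_one (F := fun y => F (T^[n] y)) ?_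
    exact Integrable.bdd_mul (c := B) hg
      ((hF.comp ((T_meas.iterate n).comp T_meas)).aestronglyMeasurable)
      (Filter.Eventually.of_forall fun x => hB _)

lemma conv_n {h : ℝ → ℝ} {Kh : ℝ} (hh : LipI h Kh) (h1 : ∫ x in Set.Ico (0 : ℝ) 1, h x = 1)
    (hfix : ∀ x ∈ Set.Icc (0 : ℝ) 1, L0 h x = h x)
    {F : ℝ → ℝ} {B : ℝ} (hF : Measurable F) (hB : ∀ x, |F x| ≤ B)
    {g : ℝ → ℝ} {K : ℝ} (hg : LipI g K) :
    Tendsto (fun n : ℕ => ∫ x in Set.Ico (0 : ℝ) 1, F (T^[n] x) * g x) atTop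
      (nhds ((∫ x in Set.Ico (0 : ℝ) 1, g x) * ∫ x in Set.Ico (0 : ℝ) 1, F x * h x)) := by
  set c := ∫ x in Set.Ico (0 : ℝ) 1, g x with hc
  have hB0 : 0 ≤ B := (abs_nonneg _).trans (hB 0)
  have hw : LipI (fun x => g x - c * h x) (K + |c| * Kh) := by
    intro x hx y hy
    have e : g x - c * h x - (g y - c * h y) = (g x - g y) - c * (h x - h y) := by ring
    rw [e]
    refine (abs_sub _ _).trans ?_
    rw [abs_mul]
    have := mul_le_mul_of_nonneg_left (hh x hx y hy) (abs_nonneg c)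
    linarith [hg x hx y hy]
  have hw0 : ∫ x in Set.Ico (0 : ℝ) 1, (g x - c * h x) = 0 := by
    rw [integral_sub hg.intg (hh.intg.const_mul c), integral_const_mul, h1, mul_one, sub_self]
  have hit : ∀ n : ℕ, ∀ x ∈ Set.Icc (0 : ℝ) 1,
      (L0^[n] (fun x => g x - c * h x)) x = (L0^[n] g) x - c * h x := by
    intro n
    induction n with
    | zero => intro x hx; rfl
    | succ n ih =>
      intro x hx
      simp only [Function.iterate_succ_apply']
      rw [← hfix x hx]
      unfold L0
      rw [Finset.mul_sum, ← Finset.sum_sub_distrib]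
      refine Finset.sum_congr rfl fun i hi => ?_
      have := ih (br i x) (br_mem hi hx)
      unfold L0 at this
      rw [this]; ring
  have hiI : ∀ n : ℕ, IntegrableOn (L0^[n] g) (Set.Ico 0 1) := by
    intro n
    induction n with
    | zero => exact hg.intg
    | succ n ih => rw [Function.iterate_succ_apply']; exact L0_intg ih
  have hFI : ∀ {u : ℝ → ℝ}, IntegrableOn u (Set.Ico 0 1) →
      IntegrableOn (fun x => F x * u x) (Set.Ico 0 1) := fun hu =>
    Integrable.bdd_mul (c := B) hu hF.aestronglyMeasurable (Filter.Eventually.of_forall fun x => hB _)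
  rw [tendsto_iff_dist_tendsto_zero]
  have hlim : Tendsto (fun n : ℕ => B * ((2 / 3 : ℝ) ^ n * (K + |c| * Kh) / 2)) atTop (nhds 0) := by
    have := (tendsto_pow_atTop_nhds_zero_of_lt_one (r := (2 / 3 : ℝ)) (by norm_num)
      (by norm_num)).const_mul (B * (K + |c| * Kh) / 2)
    rw [mul_zero] at this
    refine this.congr fun n => by ring
  refine squeeze_zero (fun n => dist_nonneg) (fun n => ?_) hlim
  rw [Real.dist_eq, dual_n hF hB n hg.intg, ← integral_const_mul,
    ← integral_sub (hFI (hiI n)) ((hFI hh.intg).const_mul c)]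
  have hone : ∫ x in Set.Ico (0 : ℝ) 1, B * ((2 / 3 : ℝ) ^ n * (K + |c| * Kh) / 2) =
    B * ((2 / 3 : ℝ) ^ n * (K + |c| * Kh) / 2) := by simp
  rw [← hone, ← Real.norm_eq_abs]
  refine norm_integral_le_of_norm_le (integrable_const _) ?_
  refine (ae_restrict_iff' measurableSet_Ico).2 (Filter.Eventually.of_forall fun x hx => ?_)
  have hx' := Set.Ico_subset_Icc_self hx
  have e : F x * (L0^[n] g) x - c * (F x * h x) = F x * (L0^[n] (fun x => g x - c * h x)) x := by
    rw [hit n x hx']; ring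
  rw [e, norm_mul]
  have h5 := bound_of_mean (L0_iter hw hw0 n).1 (L0_iter hw hw0 n).2 hx'
  exact mul_le_mul (hB x) h5 (abs_nonneg _) hB0

lemma approx {ρ : ℝ → ℝ} (hρ : Integrable ρ) {ε : ℝ} (hε : 0 < ε) :
    ∃ q : ℝ → ℝ, ∃ K : ℝ, LipI q K ∧ ∫ x in Set.Ico (0 : ℝ) 1, |ρ x - q x| ≤ ε := by
  obtain ⟨g, -, hg, hgc, hgi⟩ := hρ.exists_hasCompactSupport_integral_sub_le (half_pos hε)
  obtain ⟨p, hp⟩ := exists_polynomial_near_of_continuousOn 0 1 g hgc.continuousOn (ε / 2)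
    (half_pos hε)
  obtain ⟨K, hK⟩ : ∃ K : NNReal, LipschitzOnWith K (fun x => p.eval x) (Set.Icc (0 : ℝ) 1) :=
    ContDiffOn.exists_lipschitzOnWith (n := 1) (by simpa using (p.contDiff_aeval (𝕜 := ℝ) 1).contDiffOn) (by norm_num)
      (convex_Icc 0 1) isCompact_Icc
  have hL : LipI (fun x => p.eval x) K := fun x hx y hy => by
    have := hK.dist_le_mul x hx y hy
    rwa [Real.dist_eq, Real.dist_eq] at this
  refine ⟨_, K, hL, ?_⟩
  have hI1 : IntegrableOn (fun x => |ρ x - g x|) (Set.Ico 0 1) := (hρ.sub hgi).abs.integrableOn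
  have hc : ∫ x in Set.Ico (0 : ℝ) 1, (ε / 2) = ε / 2 := by simp
  calc ∫ x in Set.Ico (0 : ℝ) 1, |ρ x - p.eval x|
      ≤ ∫ x in Set.Ico (0 : ℝ) 1, (|ρ x - g x| + ε / 2) := by
        refine setIntegral_mono_on (hρ.integrableOn.sub hL.intg).abs (hI1.add (by simp))
          measurableSet_Ico fun x hx => ?_
        have := hp x (Set.Ico_subset_Icc_self hx)
        rw [abs_sub_comm] at this
        linarith [abs_sub_le (ρ x) (g x) (p.eval x)]
    _ = (∫ x in Set.Ico (0 : ℝ) 1, |ρ x - g x|) + ε / 2 := by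
        rw [integral_add hI1 (by simp), hc]
    _ ≤ (∫ x, |ρ x - g x|) + ε / 2 := by
        gcongr
        · exact Filter.Eventually.of_forall fun x => abs_nonneg _
        · exact (hρ.sub hgi).abs
        · exact Measure.restrict_le_self
    _ ≤ ε := by
        simp only [Real.norm_eq_abs] at hg
        linarith

lemma ident {h : ℝ → ℝ} {Kh : ℝ} (hh : LipI h Kh) (h1 : ∫ x in Set.Ico (0 : ℝ) 1, h x = 1)
    (hfix : ∀ x ∈ Set.Icc (0 : ℝ) 1, L0 h x = h x)
    {F : ℝ → ℝ} {B : ℝ} (hF : Measurable F) (hB : ∀ x, |F x| ≤ B)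
    (μ : Measure ℝ) [IsProbabilityMeasure μ]
    (hsupp : μ (Set.Ico (0 : ℝ) 1)ᶜ = 0)
    (hinv : ∀ A : Set ℝ, MeasurableSet A → μ (T ⁻¹' A) = μ A)
    (hac : μ ≪ volume) :
    ∫ x, F x ∂μ = ∫ x in Set.Ico (0 : ℝ) 1, F x * h x := by
  have hB0 : 0 ≤ B := (abs_nonneg _).trans (hB 0)
  have hmp : MeasurePreserving T μ μ := ⟨T_meas, by
    ext A hA
    rw [Measure.map_apply T_meas hA, hinv A hA]⟩
  set ρ : ℝ → ℝ := fun x => (μ.rnDeriv volume x).toReal with hρdef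
  have hρ : Integrable ρ := Measure.integrable_toReal_rnDeriv
  have hres : μ.restrict (Set.Ico (0 : ℝ) 1) = μ := Measure.restrict_eq_self_of_ae_mem
    (by rw [ae_iff]; exact hsupp)
  have hrep : ∀ G : ℝ → ℝ, ∫ x, G x ∂μ = ∫ x in Set.Ico (0 : ℝ) 1, G x * ρ x := by
    intro G
    conv_lhs => rw [← hres]
    rw [← setIntegral_toReal_rnDeriv_mul hac measurableSet_Ico]
    simp only [mul_comm, hρdef]
  have hρ1 : ∫ x in Set.Ico (0 : ℝ) 1, ρ x = 1 := by
    have := hrep (fun _ => 1)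
    simpa using this.symm
  have hA : ∀ n : ℕ, ∫ x, F x ∂μ = ∫ x in Set.Ico (0 : ℝ) 1, F (T^[n] x) * ρ x := by
    intro n
    rw [← hrep (fun x => F (T^[n] x))]
    conv_lhs => rw [← (hmp.iterate n).map_eq]
    rw [integral_map (T_meas.iterate n).aemeasurable hF.aestronglyMeasurable]
  set A := ∫ x, F x ∂μ
  set D := ∫ x in Set.Ico (0 : ℝ) 1, F x * h x
  have hmain : ∀ ε : ℝ, 0 < ε → |A - D| ≤ ε * (B + |D|) := by
    intro ε hε
    obtain ⟨q, K, hq, hqε⟩ := approx hρ hε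
    have hlim := conv_n hh h1 hfix hF hB hq
    have hbd : ∀ n : ℕ, |A - ∫ x in Set.Ico (0 : ℝ) 1, F (T^[n] x) * q x| ≤ B * ε := by
      intro n
      have hm : AEStronglyMeasurable (fun x => F (T^[n] x))
        (volume.restrict (Set.Ico (0 : ℝ) 1)) :=
        (hF.comp (T_meas.iterate n)).aestronglyMeasurable
      have hb : ∀ᵐ x ∂(volume.restrict (Set.Ico (0 : ℝ) 1)), ‖F (T^[n] x)‖ ≤ B :=
        Filter.Eventually.of_forall fun x => hB _
      rw [hA n, ← integral_sub (Integrable.bdd_mul (c := B) hρ.integrableOn hm hb)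
        (Integrable.bdd_mul (c := B) hq.intg hm hb), ← Real.norm_eq_abs]
      calc _ ≤ ∫ x in Set.Ico (0 : ℝ) 1, B * |ρ x - q x| := by
            refine norm_integral_le_of_norm_le ((hρ.integrableOn.sub hq.intg).abs.const_mul B) ?_
            refine Filter.Eventually.of_forall fun x => ?_
            rw [← mul_sub, norm_mul]
            exact mul_le_mul_of_nonneg_right (hB _) (abs_nonneg _)
        _ ≤ B * ε := by rw [integral_const_mul]; gcongr
    have h2 : |A - (∫ x in Set.Ico (0 : ℝ) 1, q x) * D| ≤ B * ε :=
      le_of_tendsto ((tendsto_const_nhds.sub hlim).abs) (Filter.Eventually.of_forall hbd)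
    have h3 : |1 - ∫ x in Set.Ico (0 : ℝ) 1, q x| ≤ ε := by
      have e : (1 : ℝ) - ∫ x in Set.Ico (0 : ℝ) 1, q x = ∫ x in Set.Ico (0 : ℝ) 1, (ρ x - q x) := by
        rw [integral_sub hρ.integrableOn hq.intg, hρ1]
      rw [e]
      exact (abs_integral_le_integral_abs).trans hqε
    have e : A - D = (A - (∫ x in Set.Ico (0 : ℝ) 1, q x) * D) -
      (1 - ∫ x in Set.Ico (0 : ℝ) 1, q x) * D := by ring
    rw [e]
    refine (abs_sub _ _).trans ?_
    rw [abs_mul]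
    have := mul_le_mul_of_nonneg_right h3 (abs_nonneg D)
    linarith
  by_contra hne
  have hpos : 0 < |A - D| := abs_pos.2 (sub_ne_zero.2 hne)
  have hC : 0 < B + |D| + 1 := by positivity
  have := hmain (|A - D| / (B + |D| + 1)) (by positivity)
  rw [div_mul_eq_mul_div, le_div_iff₀ hC] at this
  nlinarith
lemma phi_le {x : ℝ} (hx : x ∈ Set.Icc (0 : ℝ) 1) :
    |Real.log (2 * x + 2)| ≤ 3 := by
  have h1 := Real.log_le_sub_one_of_pos (show 0 < 2 * x + 2 by linarith [hx.1])
  have h2 := Real.log_nonneg (show 1 ≤ 2 * x + 2 by linarith [hx.1])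
  rw [abs_of_nonneg h2]
  linarith [hx.2]

lemma phi_lip : LipI (fun x => Real.log (2 * x + 2)) 1 := by
  have key : ∀ x ∈ Set.Icc (0 : ℝ) 1, ∀ y ∈ Set.Icc (0 : ℝ) 1,
      Real.log (2 * x + 2) - Real.log (2 * y + 2) ≤ |x - y| := by
    intro x hx y hy
    have hxp : 0 < 2 * x + 2 := by linarith [hx.1]
    have hyp : 0 < 2 * y + 2 := by linarith [hy.1]
    rw [← Real.log_div hxp.ne' hyp.ne']
    refine (Real.log_le_sub_one_of_pos (by positivity)).trans ?_
    rw [sub_le_iff_le_add, div_le_iff₀ hyp]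
    have := le_abs_self (x - y)
    nlinarith [abs_nonneg (x - y), hy.1, mul_nonneg (abs_nonneg (x - y)) hy.1]
  intro x hx y hy
  rw [one_mul, abs_sub_le_iff]
  exact ⟨key x hx y hy, by rw [abs_sub_comm]; exact key y hy x hx⟩

lemma LipI.mul {f g : ℝ → ℝ} {K M K' M' : ℝ} (hf : LipI f K) (hg : LipI g K')
    (hM : ∀ x ∈ Set.Icc (0 : ℝ) 1, |f x| ≤ M) (hM' : ∀ x ∈ Set.Icc (0 : ℝ) 1, |g x| ≤ M') :
    LipI (fun x => f x * g x) (K * M' + M * K') := by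
  intro x hx y hy
  have e : f x * g x - f y * g y = (f x - f y) * g x + f y * (g x - g y) := by ring
  show |f x * g x - f y * g y| ≤ _
  rw [e]
  refine (abs_add_le _ _).trans ?_
  rw [abs_mul, abs_mul]
  have h1 := mul_le_mul (hf x hx y hy) (hM' x hx) (abs_nonneg _)
    (mul_nonneg (lip_const hf) (abs_nonneg _))
  have h2 := mul_le_mul (hM y hy) (hg x hx y hy) (abs_nonneg _) ((abs_nonneg _).trans (hM y hy))
  linarith

lemma LipI.bdd {f : ℝ → ℝ} {K : ℝ} (hf : LipI f K) :
    ∃ M, 0 ≤ M ∧ ∀ x ∈ Set.Icc (0 : ℝ) 1, |f x| ≤ M := by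
  have hK := lip_const hf
  refine ⟨|f 0| + K, by positivity, fun x hx => ?_⟩
  have h1 := hf x hx 0 (by simp)
  have h2 : |f x| ≤ |f x - f 0| + |f 0| := by
    have := abs_add_le (f x - f 0) (f 0)
    rwa [sub_add_cancel] at this
  rw [sub_zero, abs_of_nonneg hx.1] at h1
  nlinarith [hx.2]

lemma Lt_eq (t : ℝ) (f : ℝ → ℝ) {x : ℝ} (hx : x ∈ Set.Icc (0 : ℝ) 1) :
    Lt t f x = L0 (fun y => Real.exp (-(t * Real.log (2 * y + 2))) * f y) x := by
  unfold Lt L0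
  refine Finset.sum_congr rfl fun i hi => ?_
  have h1 : (1 : ℝ) ≤ i := by exact_mod_cast (Finset.mem_Icc.1 hi).1
  have hs : 0 < 2 * Real.sqrt (i + x) := by
    have := Real.sqrt_pos.2 (show 0 < (i : ℝ) + x by linarith [hx.1])
    positivity
  unfold br wt
  beta_reduce
  rw [show 2 * (Real.sqrt (i + x) - 1) + 2 = 2 * Real.sqrt (i + x) by ring,
    Real.rpow_def_of_pos hs, one_div,
    show Real.log (2 * Real.sqrt (i + x)) * -(1 + t) =
      -Real.log (2 * Real.sqrt (i + x)) + -(t * Real.log (2 * Real.sqrt (i + x))) by ring,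
    Real.exp_add, Real.exp_neg, Real.exp_log hs, mul_assoc]

lemma Lt_mono (t : ℝ) {f g : ℝ → ℝ} (h : ∀ x ∈ Set.Icc (0 : ℝ) 1, f x ≤ g x) :
    ∀ x ∈ Set.Icc (0 : ℝ) 1, Lt t f x ≤ Lt t g x := by
  intro x hx
  rw [Lt_eq t f hx, Lt_eq t g hx]
  unfold L0
  refine Finset.sum_le_sum fun i hi => ?_
  have := h _ (br_mem hi hx)
  exact mul_le_mul_of_nonneg_left (mul_le_mul_of_nonneg_left this (Real.exp_pos _).le)
    (wt_nonneg i x)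

lemma Lt_smul (t c : ℝ) (f : ℝ → ℝ) (x : ℝ) : Lt t (fun y => c * f y) x = c * Lt t f x := by
  unfold Lt
  rw [Finset.mul_sum]
  exact Finset.sum_congr rfl fun i hi => by ring

lemma pressure_bound {t a b α β : ℝ} {g : ℝ → ℝ} (ha : 0 < a)
    (hga : ∀ x ∈ Set.Icc (0 : ℝ) 1, a ≤ g x) (hgb : ∀ x ∈ Set.Icc (0 : ℝ) 1, g x ≤ b)
    (hα : ∀ x ∈ Set.Icc (0 : ℝ) 1, Real.exp α * g x ≤ Lt t g x)
    (hβ : ∀ x ∈ Set.Icc (0 : ℝ) 1, Lt t g x ≤ Real.exp β * g x) :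
    α ≤ P t ∧ P t ≤ β := by
  have hb : 0 < b := ha.trans_le ((hga 0 (by simp)).trans (hgb 0 (by simp)))
  have hlow : ∀ n : ℕ, ∀ x ∈ Set.Icc (0 : ℝ) 1,
      Real.exp (n * α) / b * g x ≤ ((Lt t)^[n] (fun _ => 1)) x := by
    intro n
    induction n with
    | zero =>
      intro x hx
      simp only [Nat.cast_zero, zero_mul, Real.exp_zero, Function.iterate_zero, id]
      rw [div_mul_eq_mul_div, one_mul, div_le_one hb]
      exact hgb x hx
    | succ n ih =>
      intro x hx
      rw [Function.iterate_succ_apply']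
      refine le_trans ?_ (Lt_mono t ih x hx)
      rw [Lt_smul]
      have e : Real.exp (((n + 1 : ℕ) : ℝ) * α) = Real.exp (n * α) * Real.exp α := by
        rw [← Real.exp_add]; congr 1; push_cast; ring
      rw [e]
      have := mul_le_mul_of_nonneg_left (hα x hx)
        (show 0 ≤ Real.exp (n * α) / b by positivity)
      refine le_trans (le_of_eq ?_) this
      ring
  have hup : ∀ n : ℕ, ∀ x ∈ Set.Icc (0 : ℝ) 1,
      ((Lt t)^[n] (fun _ => 1)) x ≤ Real.exp (n * β) / a * g x := by
    intro n
    induction n with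
    | zero =>
      intro x hx
      simp only [Nat.cast_zero, zero_mul, Real.exp_zero, Function.iterate_zero, id]
      rw [div_mul_eq_mul_div, one_mul, one_le_div ha]
      exact hga x hx
    | succ n ih =>
      intro x hx
      rw [Function.iterate_succ_apply']
      refine (Lt_mono t ih x hx).trans ?_
      rw [Lt_smul]
      have e : Real.exp (((n + 1 : ℕ) : ℝ) * β) = Real.exp (n * β) * Real.exp β := by
        rw [← Real.exp_add]; congr 1; push_cast; ring
      rw [e]
      have := mul_le_mul_of_nonneg_left (hβ x hx)
        (show 0 ≤ Real.exp (n * β) / a by positivity)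
      refine this.trans (le_of_eq ?_)
      ring
  have habs : ∀ n : ℕ, ∀ x ∈ Set.Icc (0 : ℝ) 1,
      |((Lt t)^[n] (fun _ => 1)) x| ≤ Real.exp (n * β) * (b / a) := by
    intro n x hx
    have h0 : 0 ≤ ((Lt t)^[n] (fun _ => 1)) x := by
      refine le_trans ?_ (hlow n x hx)
      have := ha.trans_le (hga x hx)
      positivity
    rw [abs_of_nonneg h0]
    refine (hup n x hx).trans ?_
    calc _ ≤ Real.exp (n * β) / a * b := by gcongr; exact hgb x hx
      _ = _ := by ring
  have hS1 : ∀ n : ℕ, supNorm ((Lt t)^[n] (fun _ => 1)) ≤ Real.exp (n * β) * (b / a) := by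
    intro n
    have : Nonempty (Set.Icc (0 : ℝ) 1) := ⟨⟨0, by simp⟩⟩
    exact ciSup_le fun x => habs n x x.2
  have hS2 : ∀ n : ℕ, Real.exp (n * α) * (a / b) ≤ supNorm ((Lt t)^[n] (fun _ => 1)) := by
    intro n
    have hbd : BddAbove (Set.range fun x : Set.Icc (0 : ℝ) 1 => |((Lt t)^[n] (fun _ => 1)) x|) := by
      refine ⟨Real.exp (n * β) * (b / a), ?_⟩
      rintro _ ⟨x, rfl⟩
      exact habs n x x.2
    refine le_trans ?_ (le_ciSup hbd ⟨0, by simp⟩)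
    refine le_trans ?_ (le_abs_self _)
    refine le_trans ?_ (hlow n 0 (by simp))
    calc _ = Real.exp (n * α) / b * a := by ring
      _ ≤ _ := by gcongr; exact hga 0 (by simp)
  have hU : ∀ᶠ n : ℕ in atTop, (1 / n : ℝ) * Real.log (supNorm ((Lt t)^[n] (fun _ => 1))) ≤
      β + Real.log (b / a) / n := by
    filter_upwards [eventually_gt_atTop 0] with n hn
    have hn' : (0 : ℝ) < n := by exact_mod_cast hn
    have h1 := Real.log_le_log ((show 0 < Real.exp (n * α) * (a / b) by positivity).trans_le
      (hS2 n)) (hS1 n)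
    rw [Real.log_mul (Real.exp_pos _).ne' (by positivity), Real.log_exp] at h1
    calc _ ≤ (1 / n : ℝ) * (n * β + Real.log (b / a)) := by gcongr
      _ = _ := by field_simp
  have hD : ∀ᶠ n : ℕ in atTop, α + Real.log (a / b) / n ≤
      (1 / n : ℝ) * Real.log (supNorm ((Lt t)^[n] (fun _ => 1))) := by
    filter_upwards [eventually_gt_atTop 0] with n hn
    have hn' : (0 : ℝ) < n := by exact_mod_cast hn
    have h1 := Real.log_le_log (show 0 < Real.exp (n * α) * (a / b) by positivity) (hS2 n)
    rw [Real.log_mul (Real.exp_pos _).ne' (by positivity), Real.log_exp] at h1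
    calc _ = (1 / n : ℝ) * (n * α + Real.log (a / b)) := by field_simp
      _ ≤ _ := by gcongr
  have limU : Tendsto (fun n : ℕ => β + Real.log (b / a) / n) atTop (nhds β) := by
    have := (tendsto_const_div_atTop_nhds_zero_nat (Real.log (b / a))).const_add β
    rwa [add_zero] at this
  have limD : Tendsto (fun n : ℕ => α + Real.log (a / b) / n) atTop (nhds α) := by
    have := (tendsto_const_div_atTop_nhds_zero_nat (Real.log (a / b))).const_add α
    rwa [add_zero] at this
  have bU := limU.isBoundedUnder_le.mono_le hU
  have bD := limD.isBoundedUnder_ge.mono_ge hD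
  unfold P
  constructor
  · rw [← limD.limsup_eq]
    exact limsup_le_limsup hD limD.isCoboundedUnder_le bU
  · rw [← limU.limsup_eq]
    exact limsup_le_limsup hU bD.isCoboundedUnder_le limU.isBoundedUnder_le

lemma L0_abs {E : ℝ → ℝ} {C : ℝ} (hE : ∀ x ∈ Set.Icc (0 : ℝ) 1, |E x| ≤ C) {x : ℝ}
    (hx : x ∈ Set.Icc (0 : ℝ) 1) : |L0 E x| ≤ 3 / 2 * C := by
  have hC : 0 ≤ C := (abs_nonneg _).trans (hE x hx)
  unfold L0
  refine (Finset.abs_sum_le_sum_abs _ _).trans ?_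
  have : ∀ i ∈ Finset.Icc (1 : ℕ) 3, |wt i x * E (br i x)| ≤ 1 / 2 * C := by
    intro i hi
    rw [abs_mul, abs_of_nonneg (wt_nonneg i x)]
    exact mul_le_mul (wt_le hi hx) (hE _ (br_mem hi hx)) (abs_nonneg _) (by norm_num)
  refine (Finset.sum_le_sum this).trans ?_
  simp
  linarith

/-- second order expansion bound -/
lemma exp_err {t p h u Mp M U : ℝ} (hp : |p| ≤ Mp) (ht : |t| * Mp ≤ 1) (ht1 : |t| ≤ 1)
    (hh : |h| ≤ M) (hu : |u| ≤ U) :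
    |Real.exp (-(t * p)) * (h + t * u) - (h + t * u - t * (p * h))| ≤
      (Mp ^ 2 * (M + U) + Mp * U) * t ^ 2 := by
  have hMp : 0 ≤ Mp := (abs_nonneg _).trans hp
  have hM : 0 ≤ M := (abs_nonneg _).trans hh
  have hU : 0 ≤ U := (abs_nonneg _).trans hu
  have h1 : |-(t * p)| ≤ 1 := by
    rw [abs_neg, abs_mul]
    exact (mul_le_mul_of_nonneg_left hp (abs_nonneg t)).trans ht
  have h2 := Real.abs_exp_sub_one_sub_id_le h1
  have h3 : (-(t * p)) ^ 2 ≤ t ^ 2 * Mp ^ 2 := by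
    rw [neg_sq, mul_pow]
    have : p ^ 2 ≤ Mp ^ 2 := by rw [← sq_abs p]; gcongr
    gcongr
  have h4 : |h + t * u| ≤ M + U := by
    refine (abs_add_le _ _).trans ?_
    rw [abs_mul]
    have := mul_le_mul ht1 hu (abs_nonneg _) zero_le_one
    linarith
  have h5 : |p * u| ≤ Mp * U := by
    rw [abs_mul]; gcongr
  have e : Real.exp (-(t * p)) * (h + t * u) - (h + t * u - t * (p * h)) =
    (Real.exp (-(t * p)) - 1 - -(t * p)) * (h + t * u) - t ^ 2 * (p * u) := by ring
  rw [e]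
  refine (abs_sub _ _).trans ?_
  rw [abs_mul, abs_mul, abs_of_nonneg (sq_nonneg t)]
  have h6 := mul_le_mul (h2.trans h3) h4 (abs_nonneg _) (by positivity)
  have h7 := mul_le_mul_of_nonneg_left h5 (sq_nonneg t)
  linarith

lemma main_est {h u : ℝ → ℝ} {M U H HH : ℝ} (hM : ∀ x ∈ Set.Icc (0 : ℝ) 1, |h x| ≤ M)
    (hU : ∀ x ∈ Set.Icc (0 : ℝ) 1, |u x| ≤ U) (hH : |H| ≤ HH)
    (hlow : ∀ x ∈ Set.Icc (0 : ℝ) 1, 2 / 5 ≤ h x)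
    (hfix : ∀ x ∈ Set.Icc (0 : ℝ) 1, L0 h x = h x)
    (hu : ∀ x ∈ Set.Icc (0 : ℝ) 1,
      u x - L0 u x = H * h x - L0 (fun y => Real.log (2 * y + 2) * h y) x) :
    ∃ C : ℝ, ∀ᶠ t : ℝ in nhds 0, |P t + t * H| ≤ C * t ^ 2 := by
  have hM0 : 0 ≤ M := (abs_nonneg _).trans (hM 0 (by simp))
  have hU0 : 0 ≤ U := (abs_nonneg _).trans (hU 0 (by simp))
  have hH0 : 0 ≤ HH := (abs_nonneg _).trans hH
  set C := 3 / 2 * (3 ^ 2 * (M + U) + 3 * U) + (HH ^ 2 * (M + U) + HH * U) with hC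
  have hC0 : 0 ≤ C := by positivity
  refine ⟨30 * C, ?_⟩
  have ev : ∀ c d : ℝ, 0 < d → ∀ᶠ t : ℝ in nhds 0, |t| * c < d := by
    intro c d hd
    have hcont : ContinuousAt (fun t : ℝ => |t| * c) 0 := by fun_prop
    exact hcont.eventually_lt continuousAt_const (by simpa using hd)
  filter_upwards [ev 3 1 one_pos, ev HH 1 one_pos, ev U (1 / 5) (by norm_num),
    ev (15 * C) (1 / 2) (by norm_num)] with t t3 tH tU tC
  have t1 : |t| ≤ 1 := by linarith [abs_nonneg t]
  set g : ℝ → ℝ := fun x => h x + t * u x with hg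
  have htu : ∀ x ∈ Set.Icc (0 : ℝ) 1, |t * u x| ≤ 1 / 5 := by
    intro x hx
    rw [abs_mul]
    exact (mul_le_mul_of_nonneg_left (hU x hx) (abs_nonneg t)).trans tU.le
  have hg1 : ∀ x ∈ Set.Icc (0 : ℝ) 1, 1 / 5 ≤ g x := by
    intro x hx
    have := (abs_le.1 (htu x hx)).1
    have := hlow x hx
    simp only [hg]; linarith
  have hg2 : ∀ x ∈ Set.Icc (0 : ℝ) 1, g x ≤ M + 1 / 5 := by
    intro x hx
    have := (abs_le.1 (htu x hx)).2
    have := (abs_le.1 (hM x hx)).2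
    simp only [hg]; linarith
  have key : ∀ x ∈ Set.Icc (0 : ℝ) 1, |Lt t g x - Real.exp (-(t * H)) * g x| ≤ C * t ^ 2 := by
    intro x hx
    rw [Lt_eq t g hx]
    set E : ℝ → ℝ := fun y => Real.exp (-(t * Real.log (2 * y + 2))) * (h y + t * u y) -
      (h y + t * u y - t * (Real.log (2 * y + 2) * h y)) with hE
    have hEb := L0_abs (E := E) (fun y hy => exp_err (phi_le hy) t3.le t1 (hM y hy) (hU y hy)) hx
    have hE' := exp_err (t := t) hH tH.le t1 (hM x hx) (hU x hx)
    have e1 : L0 (fun y => Real.exp (-(t * Real.log (2 * y + 2))) * g y) x = L0 E x +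
        (L0 h x + t * L0 u x - t * L0 (fun y => Real.log (2 * y + 2) * h y) x) := by
      simp only [L0, hE, hg, Finset.mul_sum, ← Finset.sum_add_distrib, ← Finset.sum_sub_distrib]
      exact Finset.sum_congr rfl fun i hi => by ring
    have e2 : L0 h x + t * L0 u x - t * L0 (fun y => Real.log (2 * y + 2) * h y) x =
        h x + t * u x - t * (H * h x) := by
      rw [hfix x hx]; linear_combination (-t) * hu x hx
    rw [e1, e2]
    have e3 : L0 E x + (h x + t * u x - t * (H * h x)) - Real.exp (-(t * H)) * g x =
      L0 E x - (Real.exp (-(t * H)) * (h x + t * u x) - (h x + t * u x - t * (H * h x))) := by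
      simp only [hg]; ring
    rw [e3]
    refine (abs_sub _ _).trans ?_
    rw [hC]; linarith
  set s := 15 * C * t ^ 2 with hs
  have hs0 : 0 ≤ s := by positivity
  have hs1 : s ≤ 1 / 2 := by
    have : t ^ 2 ≤ |t| := by
      rw [← sq_abs t]; nlinarith [abs_nonneg t]
    have h2 := mul_le_mul_of_nonneg_left this (show 0 ≤ 15 * C by positivity)
    rw [hs]; linarith
  have hexp : 1 / 3 ≤ Real.exp (-(t * H)) := by
    have h1 : |t * H| ≤ 1 := by
      rw [abs_mul]
      exact (mul_le_mul_of_nonneg_left hH (abs_nonneg t)).trans tH.le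
    have h2 : Real.exp (-1) ≤ Real.exp (-(t * H)) :=
      Real.exp_le_exp.2 (by linarith [(abs_le.1 h1).2])
    have h3 : (1 / 3 : ℝ) ≤ Real.exp (-1) := by
      rw [Real.exp_neg, ← one_div]
      exact one_div_le_one_div_of_le (Real.exp_pos _) (by linarith [Real.exp_one_lt_d9])
    linarith
  have key2 : ∀ x ∈ Set.Icc (0 : ℝ) 1,
      |Lt t g x - Real.exp (-(t * H)) * g x| ≤ s * (Real.exp (-(t * H)) * g x) := by
    intro x hx
    refine (key x hx).trans ?_
    have h1 : (1 / 15 : ℝ) ≤ Real.exp (-(t * H)) * g x := by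
      have := mul_le_mul hexp (hg1 x hx) (by norm_num) (Real.exp_pos _).le
      linarith
    have := mul_le_mul_of_nonneg_left h1 hs0
    rw [hs] at this ⊢
    linarith
  have hes1 : Real.exp (-(2 * s)) ≤ 1 - s := by
    rw [Real.exp_neg, inv_le_comm₀ (Real.exp_pos _) (by linarith), ← one_div]
    have := Real.add_one_le_exp (2 * s)
    rw [div_le_iff₀ (by linarith)]
    nlinarith
  have hes2 : 1 + s ≤ Real.exp (2 * s) := by linarith [Real.add_one_le_exp (2 * s)]
  have fin := pressure_bound (t := t) (α := -(t * H) + -(2 * s)) (β := -(t * H) + 2 * s)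
    (show (0 : ℝ) < 1 / 5 by norm_num) hg1 hg2 ?_ ?_
  · rw [abs_le]
    rw [hs] at fin
    constructor <;> linarith [fin.1, fin.2]
  · intro x hx
    have h1 := (abs_le.1 (key2 x hx)).1
    have h2 : 0 < Real.exp (-(t * H)) * g x :=
      mul_pos (Real.exp_pos _) (by linarith [hg1 x hx])
    rw [Real.exp_add]
    have := mul_le_mul_of_nonneg_left hes1 h2.le
    linarith
  · intro x hx
    have h1 := (abs_le.1 (key2 x hx)).2
    have h2 : 0 < Real.exp (-(t * H)) * g x :=
      mul_pos (Real.exp_pos _) (by linarith [hg1 x hx])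
    rw [Real.exp_add]
    have := mul_le_mul_of_nonneg_left hes2 h2.le
    linarith

theorem pressure_deriv_at_zero (μ : Measure ℝ) [IsProbabilityMeasure μ]
    (hsupp : μ (Set.Ico (0 : ℝ) 1)ᶜ = 0)
    (hinv : ∀ A : Set ℝ, MeasurableSet A → μ (T ⁻¹' A) = μ A)
    (hac : μ ≪ volume) :
    HasDerivAt P (-(∫ x, Real.log (2 * x + 2) ∂μ)) 0 := by
  obtain ⟨h, K, hh, h1, hlow, hfix⟩ := exists_h
  obtain ⟨M, hM0, hM⟩ := hh.bdd
  set H := ∫ x in Set.Ico (0 : ℝ) 1, Real.log (2 * x + 2) * h x with hH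
  have hph := phi_lip.mul hh (fun x hx => phi_le hx) hM
  obtain ⟨M2, hM20, hM2⟩ := hph.bdd
  have hLph := L0_lip hph hM2
  have hid : ∫ x, Real.log (2 * x + 2) ∂μ = H := by
    set F : ℝ → ℝ := (Set.Ico (0 : ℝ) 1).indicator (fun x => Real.log (2 * x + 2)) with hF
    have hFm : Measurable F :=
      (Measurable.log (by fun_prop)).indicator measurableSet_Ico
    have hFB : ∀ x, |F x| ≤ 3 := by
      intro x
      by_cases hx : x ∈ Set.Ico (0 : ℝ) 1
      · rw [hF, Set.indicator_of_mem hx]; exact phi_le (Set.Ico_subset_Icc_self hx)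
      · rw [hF, Set.indicator_of_notMem hx]; norm_num
    have e1 : ∫ x, Real.log (2 * x + 2) ∂μ = ∫ x, F x ∂μ := by
      refine integral_congr_ae ?_
      have : ∀ᵐ x ∂μ, x ∈ Set.Ico (0 : ℝ) 1 := by rw [ae_iff]; exact hsupp
      filter_upwards [this] with x hx
      rw [hF, Set.indicator_of_mem hx]
    rw [e1, ident hh h1 hfix hFm hFB μ hsupp hinv hac]
    refine setIntegral_congr_fun measurableSet_Ico fun x hx => ?_
    simp only [hF, Set.indicator_of_mem hx]
  rw [hid]
  obtain ⟨u, hu, -, hue⟩ := solve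
    (w := fun x => H * h x - L0 (fun y => Real.log (2 * y + 2) * h y) x)
    (K := |H| * K + (11 / 24 * (1 * M + 3 * K) + 39 / 100 * M2)) (by
      intro x hx y hy
      have e : ∀ a b c d : ℝ, H * a - b - (H * c - d) = H * (a - c) - (b - d) := by
        intros; ring
      rw [e]
      refine (abs_sub _ _).trans ?_
      rw [abs_mul]
      have := mul_le_mul_of_nonneg_left (hh x hx y hy) (abs_nonneg H)
      have h3 := hLph x hx y hy
      linarith) (by
      rw [integral_sub (hh.intg.const_mul H) hLph.intg, integral_const_mul, h1,
        int_L0 hph.intg, ← hH]; ring)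
  obtain ⟨U, hU0, hU⟩ := hu.bdd
  obtain ⟨C, hC⟩ := main_est hM hU (le_refl |H|) hlow hfix hue
  have hP0 : P 0 = 0 := by
    have := hC.self_of_nhds
    simpa using this
  rw [hasDerivAt_iff_isLittleO_nhds_zero]
  refine Asymptotics.IsBigO.trans_isLittleO (g := fun t : ℝ => t ^ 2) ?_
    (Asymptotics.isLittleO_pow_id one_lt_two)
  refine Asymptotics.IsBigO.of_bound C ?_
  filter_upwards [hC] with t ht
  rw [zero_add, hP0, Real.norm_eq_abs, Real.norm_eq_abs, abs_of_nonneg (sq_nonneg t)]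
  simp only [smul_eq_mul, sub_zero]
  rwa [mul_neg, sub_neg_eq_add]
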